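/- Suppose the noisy measurements Y(r,m,k) = |X_{w_r}(Lm,k)|² + ε(r,m,k) have noise level |ε| = max |ε(r,m,k)|, and |x_ε(n)|² is computed from Y via the reconstruction formula (equation (14) of the paper) in place of the true squared magnitudes. Then ||x_ε(n)|² − |x(n)|²| ≤ ‖A‖₁ ‖W‖₂² |ε| for all 0 ≤ n ≤ N−1, where ‖A‖₁ = Σ_{m=0}^{N/L−1} Σ_{j,j'=0}^{L−1} |a_m(j,j')| with (a_m(j,j')) = (A_m^H A_m)^{−1}, and ‖W‖₂² = Σ_{r=1}^R Σ_{n=0}^{N−1} |w_r(n)|². -/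

import Mathlib

/-- Multiple-window short-time Fourier transform. -/
noncomputable def stft {N : ℕ} [NeZero N] (L : ℕ) (x w : ZMod N → ℂ) (m k : ℕ) : ℂ :=
  (N : ℂ)⁻¹ * ∑ n : ZMod N, x n * w (((L * m : ℕ) : ZMod N) - n) *
    Complex.exp (-(2 * Real.pi * Complex.I * (k : ℂ) * (n.val : ℂ)) / (N : ℂ))

/-- DFT of the squared magnitudes of a vector: `(1/N) ∑_n |u(n)|² e^{-2πikn/N}`. -/
noncomputable def dftSq {N : ℕ} [NeZero N] (u : ZMod N → ℂ) (k : ℕ) : ℂ :=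
  (N : ℂ)⁻¹ * ∑ n : ZMod N, (‖u n‖ ^ 2 : ℝ) *
    Complex.exp (-(2 * Real.pi * Complex.I * (k : ℂ) * (n.val : ℂ)) / (N : ℂ))

/-- The matrix `A_m = (β_r(m + jN/L))`. -/
noncomputable def Amat (N L R : ℕ) [NeZero N] (w : Fin R → ZMod N → ℂ) (m : ℕ) :
    Matrix (Fin R) (Fin L) ℂ :=
  Matrix.of fun r j => dftSq (w r) (m + j.1 * (N / L))

/-- `a_m = (A_mᴴ A_m)⁻¹`. -/
noncomputable def amat (N L R : ℕ) [NeZero N] (w : Fin R → ZMod N → ℂ) (m : ℕ) :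
    Matrix (Fin L) (Fin L) ℂ :=
  ((Amat N L R w m).conjTranspose * Amat N L R w m)⁻¹

/-- The algebraic reconstruction formula (eq. (14) of the paper) applied to data
`Z : Fin R → ℕ → ℝ` in place of `Z(w_r, m') = ∑_k |X_{w_r}(Lm',k)|²`. -/
noncomputable def recon (N L R : ℕ) [NeZero N] (w : Fin R → ZMod N → ℂ)
    (Z : Fin R → ℕ → ℝ) (n : ℕ) : ℂ :=
  (L : ℂ) / (N : ℂ) * ∑ m ∈ Finset.range (N / L), ∑ m' ∈ Finset.range (N / L),
    ∑ j : Fin L, ∑ j' : Fin L,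
      Complex.exp (-(2 * Real.pi * Complex.I) *
        ((m : ℂ) * ((m' : ℂ) * (L : ℂ) - (n : ℂ)) / (N : ℂ) - (j.1 : ℂ) * (n : ℂ) / (L : ℂ))) *
        amat N L R w m j j' *
        ∑ r : Fin R, (starRingEnd ℂ) (dftSq (w r) (m + j'.1 * (N / L))) * ((Z r m' : ℝ) : ℂ)

section RootsOfUnity

variable {N : ℕ} [NeZero N]

lemma exp_neg_eq_stdAddChar (k : ℕ) (n : ZMod N) :
    Complex.exp (-(2 * Real.pi * Complex.I * (k : ℂ) * (n.val : ℂ)) / (N : ℂ)) =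
      ZMod.stdAddChar (-((k : ZMod N) * n)) := by
  have h := ZMod.stdAddChar_coe (N := N) (-(k * n.val : ℤ))
  simp only [Int.cast_neg, Int.cast_mul, Int.cast_natCast, ZMod.natCast_zmod_val] at h
  rw [h]
  congr 1
  ring

lemma sum_range_natCast_zmod {M : Type*} [AddCommMonoid M] (f : ZMod N → M) :
    ∑ k ∈ Finset.range N, f (k : ZMod N) = ∑ k : ZMod N, f k := by
  refine Finset.sum_bij' (fun k _ => (k : ZMod N)) (fun k _ => k.val) ?_ ?_ ?_ ?_ ?_
  · simp
  · simp [ZMod.val_lt]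
  · intro a ha
    exact ZMod.val_cast_of_lt (Finset.mem_range.mp ha)
  · simp
  · simp

lemma sum_range_stdAddChar_mul (b : ZMod N) :
    ∑ k ∈ Finset.range N, ZMod.stdAddChar ((k : ZMod N) * b) = if b = 0 then (N : ℂ) else 0 := by
  rw [sum_range_natCast_zmod (fun k => ZMod.stdAddChar (k * b)),
    AddChar.sum_mulShift b (ZMod.isPrimitive_stdAddChar N), ZMod.card]
  split_ifs <;> simp

lemma dftSq_eq (u : ZMod N → ℂ) (k : ℕ) :
    dftSq u k = (N : ℂ)⁻¹ * ∑ n : ZMod N, ((‖u n‖ ^ 2 : ℝ) : ℂ) *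
      ZMod.stdAddChar (-((k : ZMod N) * n)) := by
  simp only [dftSq, exp_neg_eq_stdAddChar]

lemma stft_eq (L : ℕ) (x w : ZMod N → ℂ) (m k : ℕ) :
    stft L x w m k = (N : ℂ)⁻¹ * ∑ n : ZMod N, (x n * w (((L * m : ℕ) : ZMod N) - n)) *
      ZMod.stdAddChar (-((k : ZMod N) * n)) := by
  simp only [stft, exp_neg_eq_stdAddChar]

lemma norm_dftSq_le (u : ZMod N → ℂ) (k : ℕ) :
    ‖dftSq u k‖ ≤ (N : ℝ)⁻¹ * ∑ n : ZMod N, ‖u n‖ ^ 2 := by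
  rw [dftSq_eq, norm_mul, norm_inv, Complex.norm_natCast]
  gcongr
  refine (norm_sum_le _ _).trans (Finset.sum_le_sum fun n _ => ?_)
  rw [norm_mul, AddChar.norm_apply, mul_one, Complex.norm_real, Real.norm_of_nonneg (by positivity)]

lemma sum_range_sum_mul_stdAddChar (f : ZMod N → ℂ) (n : ZMod N) :
    ∑ k ∈ Finset.range N, (∑ a : ZMod N, f a * ZMod.stdAddChar (-((k : ZMod N) * a))) *
      ZMod.stdAddChar ((k : ZMod N) * n) = N * f n := by
  simp_rw [Finset.sum_mul]
  rw [Finset.sum_comm]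
  have h (a : ZMod N) : ∑ k ∈ Finset.range N,
      f a * ZMod.stdAddChar (-((k : ZMod N) * a)) * ZMod.stdAddChar ((k : ZMod N) * n) =
        if n = a then N * f a else 0 := by
    simp_rw [mul_assoc, ← AddChar.map_add_eq_mul]
    rw [← Finset.mul_sum]
    have h2 (k : ℕ) : -((k : ZMod N) * a) + k * n = k * (n - a) := by ring
    simp_rw [h2, sum_range_stdAddChar_mul, sub_eq_zero]
    split_ifs <;> ring
  simp [h]

lemma sum_range_norm_sq (f : ZMod N → ℂ) :
    ∑ k ∈ Finset.range N,
      ((‖∑ a : ZMod N, f a * ZMod.stdAddChar (-((k : ZMod N) * a))‖ ^ 2 : ℝ) : ℂ) =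
        N * ∑ n : ZMod N, ((‖f n‖ ^ 2 : ℝ) : ℂ) := by
  have h (k : ℕ) : ((‖∑ a : ZMod N, f a * ZMod.stdAddChar (-((k : ZMod N) * a))‖ ^ 2 : ℝ) : ℂ) =
      ∑ n : ZMod N, (starRingEnd ℂ) (f n) *
        ((∑ a : ZMod N, f a * ZMod.stdAddChar (-((k : ZMod N) * a))) *
          ZMod.stdAddChar ((k : ZMod N) * n)) := by
    rw [Complex.ofReal_pow, ← Complex.mul_conj', map_sum, Finset.mul_sum]
    refine Finset.sum_congr rfl fun n _ => ?_
    rw [map_mul, ← AddChar.map_neg_eq_conj, neg_neg]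
    ring
  simp_rw [h]
  rw [Finset.sum_comm, Finset.mul_sum]
  refine Finset.sum_congr rfl fun n _ => ?_
  rw [← Finset.mul_sum, sum_range_sum_mul_stdAddChar, Complex.ofReal_pow, ← Complex.mul_conj']
  ring

lemma sum_range_dftSq_mul_stdAddChar (x : ZMod N → ℂ) (n : ZMod N) :
    ∑ k ∈ Finset.range N, dftSq x k * ZMod.stdAddChar ((k : ZMod N) * n) =
      ((‖x n‖ ^ 2 : ℝ) : ℂ) := by
  simp_rw [dftSq_eq, mul_assoc]
  rw [← Finset.mul_sum,
    sum_range_sum_mul_stdAddChar (fun n => ((‖x n‖ ^ 2 : ℝ) : ℂ)),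
    inv_mul_cancel_left₀ (NeZero.ne _)]

lemma sum_range_norm_stft_sq (L : ℕ) (x w : ZMod N → ℂ) (m : ℕ) :
    ((∑ k ∈ Finset.range N, ‖stft L x w m k‖ ^ 2 : ℝ) : ℂ) =
      ∑ k ∈ Finset.range N, dftSq x k * dftSq w k *
        ZMod.stdAddChar ((k : ZMod N) * ((L * m : ℕ) : ZMod N)) := by
  have hN : (N : ℂ) ≠ 0 := NeZero.ne _
  set t : ZMod N := ((L * m : ℕ) : ZMod N) with ht
  have h (k : ℕ) : dftSq x k * dftSq w k * ZMod.stdAddChar ((k : ZMod N) * t) =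
      (N : ℂ)⁻¹ * ∑ a : ZMod N, ((‖x a‖ ^ 2 : ℝ) : ℂ) *
        (dftSq w k * ZMod.stdAddChar ((k : ZMod N) * (t - a))) := by
    rw [dftSq_eq x, mul_assoc, mul_assoc, Finset.sum_mul]
    congr 1
    refine Finset.sum_congr rfl fun a _ => ?_
    rw [mul_sub, sub_eq_neg_add, AddChar.map_add_eq_mul]
    ring
  simp_rw [h]
  rw [← Finset.mul_sum, Finset.sum_comm]
  simp_rw [← Finset.mul_sum, sum_range_dftSq_mul_stdAddChar]
  have h2 (k : ℕ) : ((‖stft L x w m k‖ ^ 2 : ℝ) : ℂ) = (N : ℂ)⁻¹ ^ 2 *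
      ((‖∑ a : ZMod N, (x a * w (t - a)) * ZMod.stdAddChar (-((k : ZMod N) * a))‖ ^ 2 : ℝ) : ℂ) := by
    rw [stft_eq, ← ht, norm_mul, norm_inv, Complex.norm_natCast, mul_pow, Complex.ofReal_mul,
      Complex.ofReal_pow, Complex.ofReal_inv, Complex.ofReal_natCast]
  rw [Complex.ofReal_sum]
  simp_rw [h2]
  rw [← Finset.mul_sum, sum_range_norm_sq (fun a => x a * w (t - a))]
  simp_rw [norm_mul, mul_pow, Complex.ofReal_mul]
  field_simp

end RootsOfUnity

lemma sum_range_mul_eq_sum_sum {A : Type*} [AddCommMonoid A] (M L : ℕ) (f : ℕ → A) :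
    ∑ k ∈ Finset.range (L * M), f k = ∑ m ∈ Finset.range M, ∑ j : Fin L, f (m + j.1 * M) := by
  rw [Finset.sum_range f, Finset.sum_range, Finset.sum_comm, ← Fintype.sum_prod_type',
    ← finProdFinEquiv.sum_comp]
  refine Finset.sum_congr rfl fun p _ => ?_
  simp [finProdFinEquiv, mul_comm]

lemma sum_exp_mul_stdAddChar {N L M : ℕ} [NeZero N] (hN : N = L * M) (m l j : ℕ)
    (hm : m < M) (hl : l < M) :
    ∑ t ∈ Finset.range M, Complex.exp (-(2 * Real.pi * Complex.I) *
        ((m : ℂ) * ((t : ℂ) * (L : ℂ)) / (N : ℂ))) *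
        ZMod.stdAddChar (((l + j * M : ℕ) : ZMod N) * ((L * t : ℕ) : ZMod N)) =
      if l = m then (M : ℂ) else 0 := by
  have hN0 : N ≠ 0 := NeZero.ne N
  have hM0 : M ≠ 0 := by rintro rfl; simp at hN; exact hN0 hN
  have hL0 : L ≠ 0 := by rintro rfl; simp at hN; exact hN0 hN
  have : NeZero M := ⟨hM0⟩
  have hLc : (L : ℂ) ≠ 0 := by exact_mod_cast hL0
  have hMc : (M : ℂ) ≠ 0 := by exact_mod_cast hM0
  have h (t : ℕ) : Complex.exp (-(2 * Real.pi * Complex.I) *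
        ((m : ℂ) * ((t : ℂ) * (L : ℂ)) / (N : ℂ))) *
        ZMod.stdAddChar (((l + j * M : ℕ) : ZMod N) * ((L * t : ℕ) : ZMod N)) =
      ZMod.stdAddChar ((t : ZMod M) * ((l : ZMod M) - (m : ZMod M))) := by
    have h1 : ((l + j * M : ℕ) : ZMod N) * ((L * t : ℕ) : ZMod N) = ((l * L * t : ℤ) : ZMod N) := by
      have : ((L * M : ℕ) : ZMod N) = 0 := by rw [← hN]; simp
      push_cast at this ⊢
      linear_combination (j * t : ZMod N) * this
    have h2 : (t : ZMod M) * ((l : ZMod M) - (m : ZMod M)) = ((t * (l - m) : ℤ) : ZMod M) := by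
      push_cast; rfl
    rw [h1, h2, ZMod.stdAddChar_coe, ZMod.stdAddChar_coe, ← Complex.exp_add]
    congr 1
    rw [hN]
    push_cast
    field_simp
    ring
  simp_rw [h, sum_range_stdAddChar_mul, sub_eq_zero]
  congr 1
  rw [ZMod.natCast_eq_natCast_iff', Nat.mod_eq_of_lt hm, Nat.mod_eq_of_lt hl]

lemma amat_mul_conjTranspose_mul {N L R : ℕ} [NeZero N] {w : Fin R → ZMod N → ℂ} {m : ℕ}
    (h : Matrix.rank (Amat N L R w m) = L) :
    amat N L R w m * ((Amat N L R w m).conjTranspose * Amat N L R w m) = 1 := by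
  refine Matrix.nonsing_inv_mul _ ((Matrix.isUnit_iff_isUnit_det _).mp ?_)
  open scoped ComplexOrder in
  rw [← Matrix.rank_conjTranspose_mul_self, Matrix.rank_eq_finrank_span_row] at h
  rw [← Matrix.linearIndependent_rows_iff_isUnit, linearIndependent_iff_card_eq_finrank_span,
    Fintype.card_fin, Set.finrank]
  exact h.symm

lemma recon_add (N L R : ℕ) [NeZero N] (w : Fin R → ZMod N → ℂ) (Z Z' : Fin R → ℕ → ℝ) (n : ℕ) :
    recon N L R w (fun r m => Z r m + Z' r m) n = recon N L R w Z n + recon N L R w Z' n := by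
  simp only [recon, Complex.ofReal_add, mul_add, Finset.sum_add_distrib]

/-- The reconstruction formula recovers the squared magnitudes from exact measurements. -/
lemma recon_stft {N L R : ℕ} [NeZero N] (hdvd : L ∣ N) (w : Fin R → ZMod N → ℂ)
    (hrank : ∀ m < N / L, Matrix.rank (Amat N L R w m) = L) (x : ZMod N → ℂ) (n : ℕ) :
    recon N L R w (fun r m' => ∑ k ∈ Finset.range N, ‖stft L x (w r) m' k‖ ^ 2) n =
      ((‖x ((n : ℕ) : ZMod N)‖ ^ 2 : ℝ) : ℂ) := by
  have hN : N = L * (N / L) := (Nat.mul_div_cancel' hdvd).symm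
  have hN0 : N ≠ 0 := NeZero.ne N
  have hL0 : L ≠ 0 := by rintro rfl; exact hN0 (by simpa using hN)
  have hLc : (L : ℂ) ≠ 0 := by exact_mod_cast hL0
  have hNc : (N : ℂ) ≠ 0 := by exact_mod_cast hN0
  have hMc : ((N / L : ℕ) : ℂ) = N / L := Nat.cast_div hdvd hLc
  set M := N / L with hM
  set Z : Fin R → ℕ → ℝ := fun r m' => ∑ k ∈ Finset.range N, ‖stft L x (w r) m' k‖ ^ 2 with hZ
  set v : ℕ → Fin L → ℂ := fun m j => dftSq x (m + j.1 * M) with hv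
  have hphase (m m' : ℕ) (j : Fin L) : Complex.exp (-(2 * Real.pi * Complex.I) *
        ((m : ℂ) * ((m' : ℂ) * (L : ℂ) - (n : ℂ)) / (N : ℂ) - (j.1 : ℂ) * (n : ℂ) / (L : ℂ))) =
      ZMod.stdAddChar (((m + j.1 * M : ℕ) : ZMod N) * (n : ZMod N)) *
        Complex.exp (-(2 * Real.pi * Complex.I) * ((m : ℂ) * ((m' : ℂ) * (L : ℂ)) / (N : ℂ))) := by
    have h := ZMod.stdAddChar_coe (N := N) ((m + j.1 * M : ℕ) * n : ℤ)
    rw [Int.cast_mul, Int.cast_natCast, Int.cast_natCast] at h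
    rw [h, ← Complex.exp_add]
    congr 1
    push_cast
    rw [hMc]
    field_simp
    ring
  have hfourier (m : ℕ) (hm : m < M) (r : Fin R) :
      ∑ m' ∈ Finset.range M, Complex.exp (-(2 * Real.pi * Complex.I) *
        ((m : ℂ) * ((m' : ℂ) * (L : ℂ)) / (N : ℂ))) * ((Z r m' : ℝ) : ℂ) =
        M * (Amat N L R w m).mulVec (v m) r := by
    have hsplit (m' : ℕ) : ((Z r m' : ℝ) : ℂ) = ∑ l ∈ Finset.range M, ∑ i : Fin L,
        v l i * dftSq (w r) (l + i.1 * M) *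
          ZMod.stdAddChar (((l + i.1 * M : ℕ) : ZMod N) * ((L * m' : ℕ) : ZMod N)) := by
      rw [hZ, sum_range_norm_stft_sq, ← sum_range_mul_eq_sum_sum M L (fun k =>
        dftSq x k * dftSq (w r) k * ZMod.stdAddChar ((k : ZMod N) * ((L * m' : ℕ) : ZMod N))), ← hN]
    simp_rw [hsplit, Finset.mul_sum]
    rw [Finset.sum_comm]
    have hl (l : ℕ) (hl : l ∈ Finset.range M) :
        ∑ m' ∈ Finset.range M, ∑ i : Fin L, Complex.exp (-(2 * Real.pi * Complex.I) *
          ((m : ℂ) * ((m' : ℂ) * (L : ℂ)) / (N : ℂ))) * (v l i * dftSq (w r) (l + i.1 * M) *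
          ZMod.stdAddChar (((l + i.1 * M : ℕ) : ZMod N) * ((L * m' : ℕ) : ZMod N))) =
        if l = m then M * (Amat N L R w l).mulVec (v l) r else 0 := by
      rw [Finset.sum_comm]
      simp_rw [mul_left_comm (Complex.exp _), ← Finset.mul_sum]
      simp_rw [sum_exp_mul_stdAddChar hN m l _ hm (Finset.mem_range.mp hl)]
      split_ifs
      · simp only [Matrix.mulVec, dotProduct, Amat, Matrix.of_apply, Finset.mul_sum]
        exact Finset.sum_congr rfl fun i _ => by ring
      · simp
    rw [Finset.sum_congr rfl hl, Finset.sum_ite_eq', if_pos (Finset.mem_range.mpr hm)]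
  have hinv (m : ℕ) (hm : m < M) (j : Fin L) :
      ∑ j' : Fin L, amat N L R w m j j' * ∑ r : Fin R,
        (starRingEnd ℂ) (dftSq (w r) (m + j'.1 * M)) * (Amat N L R w m).mulVec (v m) r = v m j := by
    have h := congrFun (congrArg (Matrix.mulVec · (v m))
      (amat_mul_conjTranspose_mul (hrank m hm))) j
    simp only [Matrix.one_mulVec, ← Matrix.mulVec_mulVec] at h
    exact h
  have hblock (m : ℕ) (hm : m ∈ Finset.range M) :
      ∑ m' ∈ Finset.range M, ∑ j : Fin L, ∑ j' : Fin L,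
        Complex.exp (-(2 * Real.pi * Complex.I) *
          ((m : ℂ) * ((m' : ℂ) * (L : ℂ) - (n : ℂ)) / (N : ℂ) - (j.1 : ℂ) * (n : ℂ) / (L : ℂ))) *
          amat N L R w m j j' *
          ∑ r : Fin R, (starRingEnd ℂ) (dftSq (w r) (m + j'.1 * M)) * ((Z r m' : ℝ) : ℂ) =
      M * ∑ j : Fin L, dftSq x (m + j.1 * M) *
        ZMod.stdAddChar (((m + j.1 * M : ℕ) : ZMod N) * (n : ZMod N)) := by
    rw [Finset.sum_comm, Finset.mul_sum]
    refine Finset.sum_congr rfl fun j _ => ?_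
    have hj := hinv m (Finset.mem_range.mp hm) j
    change _ = (M : ℂ) * (v m j * _)
    rw [← hj, Finset.sum_comm, Finset.sum_mul, Finset.mul_sum]
    refine Finset.sum_congr rfl fun j' _ => ?_
    simp_rw [hphase, Finset.mul_sum]
    rw [Finset.sum_comm, Finset.sum_mul, Finset.mul_sum]
    refine Finset.sum_congr rfl fun r _ => ?_
    trans ZMod.stdAddChar (((m + j.1 * M : ℕ) : ZMod N) * (n : ZMod N)) * amat N L R w m j j' *
      (starRingEnd ℂ) (dftSq (w r) (m + j'.1 * M)) * (M * (Amat N L R w m).mulVec (v m) r)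
    · rw [← hfourier m (Finset.mem_range.mp hm) r, Finset.mul_sum]
      exact Finset.sum_congr rfl fun m' _ => by ring
    · ring
  rw [recon, ← hM, Finset.sum_congr rfl hblock, ← Finset.mul_sum,
    ← sum_range_mul_eq_sum_sum M L (fun k => dftSq x k * ZMod.stdAddChar ((k : ZMod N) * (n : ZMod N))),
    ← hN, sum_range_dftSq_mul_stdAddChar, hMc]
  field_simp

lemma norm_recon_le {N L R : ℕ} [NeZero N] (hL : 0 < L) (hdvd : L ∣ N) (w : Fin R → ZMod N → ℂ)
    (Z : Fin R → ℕ → ℝ) (C : ℝ) (hZ : ∀ r, ∀ m < N / L, |Z r m| ≤ C) (n : ℕ) :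
    ‖recon N L R w Z n‖ ≤
      (∑ m ∈ Finset.range (N / L), ∑ j : Fin L, ∑ j' : Fin L, ‖amat N L R w m j j'‖) *
        (∑ r : Fin R, ∑ nn : ZMod N, ‖w r nn‖ ^ 2) * ((N : ℝ)⁻¹ * C) := by
  have hN : (N : ℝ) ≠ 0 := NeZero.ne _
  have hLr : (L : ℝ) ≠ 0 := by positivity
  set S : ℝ := ∑ r : Fin R, ∑ nn : ZMod N, ‖w r nn‖ ^ 2 with hS
  have hinner (m m' : ℕ) (hm' : m' < N / L) (j' : Fin L) :
      ‖∑ r : Fin R, (starRingEnd ℂ) (dftSq (w r) (m + j'.1 * (N / L))) * ((Z r m' : ℝ) : ℂ)‖ ≤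
        S * ((N : ℝ)⁻¹ * C) := by
    rw [hS, Finset.sum_mul]
    refine (norm_sum_le _ _).trans (Finset.sum_le_sum fun r _ => ?_)
    rw [norm_mul, RCLike.norm_conj, Complex.norm_real, Real.norm_eq_abs]
    calc _ ≤ ((N : ℝ)⁻¹ * ∑ nn : ZMod N, ‖w r nn‖ ^ 2) * C := by
          gcongr
          · exact norm_dftSq_le _ _
          · exact hZ r m' hm'
      _ = _ := by ring
  have hexp (m m' : ℕ) (j : Fin L) : ‖Complex.exp (-(2 * Real.pi * Complex.I) *
        ((m : ℂ) * ((m' : ℂ) * (L : ℂ) - (n : ℂ)) / (N : ℂ) - (j.1 : ℂ) * (n : ℂ) / (L : ℂ)))‖ = 1 := by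
    rw [← Complex.norm_exp_ofReal_mul_I (-(2 * Real.pi) *
        ((m : ℝ) * ((m' : ℝ) * (L : ℝ) - (n : ℝ)) / (N : ℝ) - (j.1 : ℝ) * (n : ℝ) / (L : ℝ)))]
    push_cast
    ring_nf
  calc ‖recon N L R w Z n‖
      ≤ (L : ℝ) / N * ∑ m ∈ Finset.range (N / L), ∑ m' ∈ Finset.range (N / L),
          ∑ j : Fin L, ∑ j' : Fin L, ‖amat N L R w m j j'‖ * (S * ((N : ℝ)⁻¹ * C)) := by
        rw [recon, norm_mul, norm_div, Complex.norm_natCast, Complex.norm_natCast]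
        gcongr
        refine norm_sum_le_of_le _ fun m _ => norm_sum_le_of_le _ fun m' hm' =>
          norm_sum_le_of_le _ fun j _ => norm_sum_le_of_le _ fun j' _ => ?_
        rw [norm_mul, norm_mul, hexp, one_mul]
        gcongr
        exact hinner m m' (Finset.mem_range.mp hm') j'
    _ = _ := by
        simp_rw [← Finset.sum_mul, Finset.sum_const, Finset.card_range, nsmul_eq_mul]
        rw [← Finset.mul_sum, Nat.cast_div hdvd hLr]
        field_simp

/-- Error estimate for the reconstructed squared magnitudes from noisy measurements:
`||x_ε(n)|² - |x(n)|²| ≤ ‖A‖₁ ‖W‖₂² |ε|`. -/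
theorem stmt17 (N L R : ℕ) [NeZero N] (hL : 0 < L) (hR : 0 < R) (hdvd : L ∣ N)
    (w : Fin R → ZMod N → ℂ)
    (hrank : ∀ m < N / L, Matrix.rank (Amat N L R w m) = L)
    (x : ZMod N → ℂ) (ε : Fin R → ℕ → ℕ → ℝ) (E : ℝ)
    (hE : ∀ r : Fin R, ∀ m < N / L, ∀ k < N, |ε r m k| ≤ E) :
    ∀ n < N,
      ‖recon N L R w
          (fun r m' => ∑ k ∈ Finset.range N, (‖stft L x (w r) m' k‖ ^ 2 + ε r m' k)) n -
        ((‖x ((n : ℕ) : ZMod N)‖ ^ 2 : ℝ) : ℂ)‖ ≤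
      (∑ m ∈ Finset.range (N / L), ∑ j : Fin L, ∑ j' : Fin L, ‖amat N L R w m j j'‖) *
        (∑ r : Fin R, ∑ nn : ZMod N, ‖w r nn‖ ^ 2) * E := by
  intro n _
  simp_rw [Finset.sum_add_distrib]
  rw [recon_add N L R w (fun r m' => ∑ k ∈ Finset.range N, ‖stft L x (w r) m' k‖ ^ 2)
      (fun r m' => ∑ k ∈ Finset.range N, ε r m' k), recon_stft hdvd w hrank, add_sub_cancel_left]
  refine (norm_recon_le hL hdvd w _ (N * E) (fun r m hm => ?_) n).trans_eq ?_
  · refine (Finset.abs_sum_le_sum_abs _ _).trans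
      ((Finset.sum_le_card_nsmul _ _ E fun k hk => hE r m hm k (Finset.mem_range.mp hk)).trans_eq ?_)
    simp
  · rw [inv_mul_cancel_left₀ (NeZero.ne _)]
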